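/- The balanced elements of G(e,e,n) of maximal length n(n−1) over the Corran–Picantin generating set are exactly λ^k for 1 ≤ k ≤ e−1, where λ is the diagonal matrix with entries ζ_e in positions (i,i) for i ≥ 2 and ζ_e^{−(n−1)} in position (1,1). In particular, any diagonal element of maximal length that has two distinct diagonal entries among positions 2,...,n is not balanced. -/

import Mathlib

noncomputable section

open Matrix

/-- The primitive `e`-th root of unity `ζ_e = exp(2πi/e)`. -/
def zeta (e : ℕ) : ℂ := Complex.exp (2 * (Real.pi : ℂ) * Complex.I / (e : ℂ))

/-- The generator `t_i` of `G(e,e,n)`: it swaps the first two coordinates with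
multipliers `ζ_e^{-i}` and `ζ_e^{i}` and is the identity elsewhere. -/
def tmat (e n i : ℕ) : Matrix (Fin n) (Fin n) ℂ :=
  Matrix.of fun p q =>
    if (p : ℕ) = 0 ∧ (q : ℕ) = 1 then (zeta e)⁻¹ ^ i
    else if (p : ℕ) = 1 ∧ (q : ℕ) = 0 then zeta e ^ i
    else if (p : ℕ) = (q : ℕ) ∧ 2 ≤ (p : ℕ) then 1 else 0

/-- The generator `s_j` of `G(e,e,n)` (`3 ≤ j ≤ n`, 1-based): the permutation
matrix of the transposition `(j-1, j)`. -/
def smat (n j : ℕ) : Matrix (Fin n) (Fin n) ℂ :=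
  Matrix.of fun p q =>
    if (p : ℕ) = j - 2 ∧ (q : ℕ) = j - 1 then 1
    else if (p : ℕ) = j - 1 ∧ (q : ℕ) = j - 2 then 1
    else if (p : ℕ) = (q : ℕ) ∧ (p : ℕ) ≠ j - 2 ∧ (p : ℕ) ≠ j - 1 then 1 else 0

/-- The Corran–Picantin generating set `X = {t_0,…,t_{e-1}, s_3,…,s_n}`. -/
def genSet (e n : ℕ) : Set (Matrix (Fin n) (Fin n) ℂ) :=
  {M | (∃ i < e, M = tmat e n i) ∨ ∃ j, 3 ≤ j ∧ j ≤ n ∧ M = smat n j}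

/-- Membership in `G(e,e,n)`: a monomial matrix whose nonzero entries are
`e`-th roots of unity with product of nonzero entries equal to `1`.
(Each row sum is the unique nonzero entry of that row.) -/
def IsGeen (e n : ℕ) (w : Matrix (Fin n) (Fin n) ℂ) : Prop :=
  (∀ i, ∃! j, w i j ≠ 0) ∧ (∀ j, ∃! i, w i j ≠ 0) ∧
  (∀ i j, w i j ≠ 0 → w i j ^ e = 1) ∧ (∏ i, ∑ j, w i j) = 1

/-- Word length over the Corran–Picantin generating set. -/
def len (e n : ℕ) (w : Matrix (Fin n) (Fin n) ℂ) : ℕ :=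
  sInf {l | ∃ L : List (Matrix (Fin n) (Fin n) ℂ),
    (∀ x ∈ L, x ∈ genSet e n) ∧ L.prod = w ∧ L.length = l}

/-- The element `λ`: diagonal with `λ[i,i] = ζ_e` for `i ≥ 2` (1-based) and
`λ[1,1] = ζ_e^{-(n-1)}`. -/
def lamMat (e n : ℕ) : Matrix (Fin n) (Fin n) ℂ :=
  Matrix.of fun p q =>
    if p = q then (if (p : ℕ) = 0 then (zeta e)⁻¹ ^ (n - 1) else zeta e) else 0

/-- Left divisibility: `u ⪯ w` iff `w = u v` with `ℓ(u) + ℓ(v) = ℓ(w)`. -/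
def LDiv (e n : ℕ) (u w : Matrix (Fin n) (Fin n) ℂ) : Prop :=
  ∃ v, IsGeen e n v ∧ u * v = w ∧ len e n u + len e n v = len e n w

/-- Right divisibility: `u ⪯_r w` iff `w = v u` with `ℓ(v) + ℓ(u) = ℓ(w)`. -/
def RDiv (e n : ℕ) (u w : Matrix (Fin n) (Fin n) ℂ) : Prop :=
  ∃ v, IsGeen e n v ∧ v * u = w ∧ len e n v + len e n u = len e n w

/-- `w` is balanced: its sets of left divisors and right divisors coincide. -/
def IsBalancedElt (e n : ℕ) (w : Matrix (Fin n) (Fin n) ℂ) : Prop :=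
  ∀ u, IsGeen e n u → (LDiv e n u w ↔ RDiv e n u w)

/-- The monomial matrix whose row `i` has its only nonzero entry `a i` in column `σ i`. -/
def monoMat {n : ℕ} (σ : Equiv.Perm (Fin n)) (a : Fin n → ℂ) : Matrix (Fin n) (Fin n) ℂ :=
  Matrix.of fun i j => if σ i = j then a i else 0

/-- Row entries of an element of `G(e,e,n)`: `e`-th roots of unity with product `1`. -/
def IsCoeff (e : ℕ) {n : ℕ} (a : Fin n → ℂ) : Prop :=
  (∀ i, a i ^ e = 1) ∧ ∏ i, a i = 1

/-- Contribution to the length of a pair of rows, increasing or not, whose lower row has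
entry `z`. -/
def pairWt (inc : Prop) [Decidable inc] (z : ℂ) : ℕ :=
  if inc then (if z = 1 then 0 else 2) else 1

/-- The pairs of rows `(j, i)` with `j < i`. -/
def rowPairs (n : ℕ) : Finset (Fin n × Fin n) :=
  Finset.univ.filter fun p => p.1 < p.2

/-- The combinatorial length of a monomial matrix. -/
def wt {n : ℕ} (σ : Equiv.Perm (Fin n)) (a : Fin n → ℂ) : ℕ :=
  ∑ p ∈ rowPairs n, pairWt (σ p.1 < σ p.2) (a p.2)

theorem mem_rowPairs {n : ℕ} {p : Fin n × Fin n} : p ∈ rowPairs n ↔ p.1 < p.2 := by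
  simp [rowPairs]

theorem monoMat_mul {n : ℕ} (σ τ : Equiv.Perm (Fin n)) (a b : Fin n → ℂ) :
    monoMat σ a * monoMat τ b = monoMat (τ * σ) fun i => a i * b (σ i) := by
  ext i j
  simp only [monoMat, Matrix.mul_apply, Matrix.of_apply, Equiv.Perm.mul_apply]
  rw [Finset.sum_eq_single (σ i) (fun k _ hk => by rw [if_neg (Ne.symm hk), zero_mul]) (by simp)]
  split_ifs <;> simp_all

theorem monoMat_one {n : ℕ} : monoMat (1 : Equiv.Perm (Fin n)) (fun _ => 1) = 1 := by
  ext i j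
  by_cases h : i = j <;> simp [monoMat, Matrix.one_apply, h]

theorem monoMat_one_eq_diagonal {n : ℕ} (a : Fin n → ℂ) :
    monoMat 1 a = Matrix.diagonal a := by
  ext i j
  by_cases h : i = j <;> simp [monoMat, h]

theorem IsCoeff.ne_zero {e n : ℕ} (he : e ≠ 0) {a : Fin n → ℂ} (ha : IsCoeff e a) (i : Fin n) :
    a i ≠ 0 := fun h => by
  have := ha.1 i
  simp [h, he] at this

theorem IsCoeff.mul {e n : ℕ} {a b : Fin n → ℂ} (ha : IsCoeff e a) (hb : IsCoeff e b)
    (σ : Equiv.Perm (Fin n)) : IsCoeff e fun i => a i * b (σ i) := by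
  refine ⟨fun i => by rw [mul_pow, ha.1, hb.1, one_mul], ?_⟩
  rw [Finset.prod_mul_distrib, Equiv.prod_comp σ b, ha.2, hb.2, one_mul]

theorem isCoeff_one {e n : ℕ} : IsCoeff e (fun _ : Fin n => (1 : ℂ)) := by
  simp [IsCoeff]

theorem IsCoeff.inv {e n : ℕ} {a : Fin n → ℂ} (ha : IsCoeff e a) (σ : Equiv.Perm (Fin n)) :
    IsCoeff e fun i => (a (σ i))⁻¹ := by
  refine ⟨fun i => by rw [inv_pow, ha.1, inv_one], ?_⟩
  rw [Equiv.prod_comp σ fun i => (a i)⁻¹, Finset.prod_inv_distrib, ha.2, inv_one]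

theorem monoMat_injective {e n : ℕ} (he : e ≠ 0) {σ τ : Equiv.Perm (Fin n)} {a b : Fin n → ℂ}
    (ha : IsCoeff e a) (h : monoMat σ a = monoMat τ b) : σ = τ ∧ a = b := by
  have key : ∀ i, τ i = σ i ∧ a i = b i := fun i => by
    have h1 : monoMat σ a i (σ i) = monoMat τ b i (σ i) := by rw [h]
    have h2 := ha.ne_zero he i
    by_cases hc : τ i = σ i
    · simp [monoMat, hc] at h1
      exact ⟨hc, h1⟩
    · simp [monoMat, hc] at h1
      exact absurd h1 h2
  exact ⟨Equiv.ext fun i => (key i).1.symm, funext fun i => (key i).2⟩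

theorem isGeen_iff {e n : ℕ} (he : e ≠ 0) {w : Matrix (Fin n) (Fin n) ℂ} :
    IsGeen e n w ↔ ∃ σ a, IsCoeff e a ∧ w = monoMat σ a := by
  constructor
  · rintro ⟨hr, hc, hp, hprod⟩
    choose f hf hf' using hr
    have hinj : Function.Injective f := fun i j hij =>
      (hc (f i)).unique (hf i) (by simpa [hij] using hf j)
    have hrow : ∀ i j, j ≠ f i → w i j = 0 := fun i j hj => by
      by_contra h
      exact hj (hf' i j h)
    have hsum : ∀ i, ∑ j, w i j = w i (f i) := fun i =>
      Finset.sum_eq_single (f i) (fun j _ hj => hrow i j hj) (by simp)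
    refine ⟨Equiv.ofBijective f (Finite.injective_iff_bijective.1 hinj), fun i => w i (f i),
      ⟨fun i => hp _ _ (hf i), by simpa [hsum] using hprod⟩, ?_⟩
    ext i j
    by_cases h : f i = j
    · simp [monoMat, h]
    · simp [monoMat, h, hrow i j (Ne.symm h)]
  · rintro ⟨σ, a, ha, rfl⟩
    have h0 := ha.ne_zero he
    refine ⟨fun i => ⟨σ i, by simp [monoMat, h0], fun j hj => ?_⟩,
      fun j => ⟨σ⁻¹ j, by simp [monoMat, h0], fun i hi => ?_⟩, fun i j hij => ?_, ?_⟩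
    · by_contra h
      exact hj (by simp [monoMat, Ne.symm h])
    · by_contra h
      refine hi ?_
      have : σ i ≠ j := fun h' => h (by simp [← h'])
      simp [monoMat, this]
    · by_cases h : σ i = j
      · simpa [monoMat, h] using ha.1 i
      · simp [monoMat, h] at hij
    · simpa [monoMat] using ha.2

theorem zeta_isPrimitiveRoot {e : ℕ} (he : e ≠ 0) : IsPrimitiveRoot (zeta e) e :=
  Complex.isPrimitiveRoot_exp e he

/-- The row entries of the generator `t_k`. -/
def tCoeff (e n k : ℕ) : Fin n → ℂ := fun i =>
  if (i : ℕ) = 0 then (zeta e)⁻¹ ^ k else if (i : ℕ) = 1 then zeta e ^ k else 1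

theorem isCoeff_tCoeff {e n : ℕ} (he : e ≠ 0) (hn : 2 ≤ n) (k : ℕ) :
    IsCoeff e (tCoeff e n k) := by
  have hz := (zeta_isPrimitiveRoot he).pow_eq_one
  have h0 := (zeta_isPrimitiveRoot he).ne_zero he
  constructor
  · intro i
    unfold tCoeff
    split_ifs
    · rw [← pow_mul, mul_comm, pow_mul, inv_pow, hz, inv_one, one_pow]
    · rw [← pow_mul, mul_comm, pow_mul, hz, one_pow]
    · simp
  · rw [Finset.prod_eq_mul (⟨0, by omega⟩ : Fin n) ⟨1, by omega⟩ (by simp)]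
    · simp [tCoeff, h0]
    · rintro c - ⟨h1, h2⟩
      simp only [ne_eq, Fin.ext_iff] at h1 h2
      simp [tCoeff, h1, h2]
    · simp
    · simp

theorem tmat_eq {e n : ℕ} (hn : 2 ≤ n) (k : ℕ) :
    tmat e n k = monoMat (Equiv.swap ⟨0, by omega⟩ ⟨1, by omega⟩) (tCoeff e n k) := by
  ext p q
  simp only [tmat, monoMat, tCoeff, Matrix.of_apply, Equiv.swap_apply_def, Fin.ext_iff]
  split_ifs <;> simp_all
  omega

theorem smat_eq {n : ℕ} {c d : Fin n} (h : (c : ℕ) + 1 = d) :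
    smat n (d + 1) = monoMat (Equiv.swap c d) fun _ => 1 := by
  ext p q
  simp only [smat, monoMat, Matrix.of_apply, Equiv.swap_apply_def, Fin.ext_iff]
  split_ifs <;> first | rfl | (exfalso; omega)

/-- `(c, d, b)` describes a generator: `c`, `d` are the adjacent columns it swaps and `b` is its
family of row entries. -/
def IsGenData (e : ℕ) {n : ℕ} (c d : Fin n) (b : Fin n → ℂ) : Prop :=
  (c : ℕ) + 1 = d ∧ IsCoeff e b ∧ (∀ x, (c : ℕ) ≠ 0 ∨ (x ≠ c ∧ x ≠ d) → b x = 1)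

theorem isGenData_tCoeff {e n : ℕ} (he : e ≠ 0) (hn : 2 ≤ n) (k : ℕ) :
    IsGenData e (⟨0, by omega⟩ : Fin n) ⟨1, by omega⟩ (tCoeff e n k) := by
  refine ⟨rfl, isCoeff_tCoeff he hn k, fun x hx => ?_⟩
  simp only [ne_eq, Fin.ext_iff, not_true_eq_false, false_or] at hx
  simp [tCoeff, hx.1, hx.2]

theorem exists_genData {e n : ℕ} (he : e ≠ 0) (hn : 2 ≤ n) {x : Matrix (Fin n) (Fin n) ℂ}
    (hx : x ∈ genSet e n) :
    ∃ c d b, IsGenData e c d b ∧ x = monoMat (Equiv.swap c d) b := by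
  rcases hx with ⟨k, -, rfl⟩ | ⟨j, hj, hjn, rfl⟩
  · exact ⟨_, _, _, isGenData_tCoeff he hn k, tmat_eq hn k⟩
  · have hcd : ((⟨j - 2, by omega⟩ : Fin n) : ℕ) + 1 = (⟨j - 1, by omega⟩ : Fin n) := by
      simp only; omega
    refine ⟨⟨j - 2, by omega⟩, ⟨j - 1, by omega⟩, fun _ => 1,
      ⟨hcd, isCoeff_one, fun _ _ => rfl⟩, ?_⟩
    rw [← smat_eq hcd]
    congr 1
    simp only; omega

theorem genSet_mul_self {e n : ℕ} (he : e ≠ 0) (hn : 2 ≤ n) {x : Matrix (Fin n) (Fin n) ℂ}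
    (hx : x ∈ genSet e n) : x * x = 1 := by
  rcases hx with ⟨k, -, rfl⟩ | ⟨j, hj, hjn, rfl⟩
  · have h0 := (zeta_isPrimitiveRoot he).ne_zero he
    rw [tmat_eq hn, monoMat_mul, Equiv.swap_mul_self, ← monoMat_one]
    congr 1
    funext i
    simp only [tCoeff, Equiv.swap_apply_def, Fin.ext_iff]
    split_ifs <;> simp_all
  · have hcd : ((⟨j - 2, by omega⟩ : Fin n) : ℕ) + 1 = (⟨j - 1, by omega⟩ : Fin n) := by
      simp only; omega
    have := smat_eq hcd
    rw [show ((⟨j - 1, by omega⟩ : Fin n) : ℕ) + 1 = j by simp only; omega] at this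
    rw [this, monoMat_mul, Equiv.swap_mul_self, ← monoMat_one]
    simp

/-- Right multiplication by a generator only affects the contribution of the pair of rows whose
columns are swapped. -/
theorem wt_mul_genData {e n : ℕ} {c d : Fin n} {b : Fin n → ℂ} (hg : IsGenData e c d b)
    (σ : Equiv.Perm (Fin n)) (a : Fin n → ℂ) {j i : Fin n} (hji : j < i)
    (h : (σ j = c ∧ σ i = d) ∨ (σ j = d ∧ σ i = c)) :
    wt (Equiv.swap c d * σ) (fun x => a x * b (σ x)) + pairWt (σ j < σ i) (a i) =
      wt σ a + pairWt (¬ σ j < σ i) (a i * b (σ i)) := by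
  have hcd := hg.1
  have hmem : (j, i) ∈ rowPairs n := mem_rowPairs.2 hji
  have hsame : ∀ p ∈ (rowPairs n).erase (j, i),
      pairWt ((Equiv.swap c d * σ) p.1 < (Equiv.swap c d * σ) p.2) (a p.2 * b (σ p.2)) =
        pairWt (σ p.1 < σ p.2) (a p.2) := by
    rintro ⟨x, y⟩ hxy
    rw [Finset.mem_erase, mem_rowPairs] at hxy
    obtain ⟨hne, hlt⟩ := hxy
    have hnot : ¬ ((σ x = c ∧ σ y = d) ∨ (σ x = d ∧ σ y = c)) := by
      intro h'
      have hinj := σ.injective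
      apply hne
      rcases h with ⟨h1, h2⟩ | ⟨h1, h2⟩ <;> rcases h' with ⟨h3, h4⟩ | ⟨h3, h4⟩
      · rw [hinj (h3.trans h1.symm), hinj (h4.trans h2.symm)]
      · have e1 := hinj (h3.trans h2.symm)
        have e2 := hinj (h4.trans h1.symm)
        subst e1 e2; exact absurd hlt hji.asymm
      · have e1 := hinj (h3.trans h2.symm)
        have e2 := hinj (h4.trans h1.symm)
        subst e1 e2; exact absurd hlt hji.asymm
      · rw [hinj (h3.trans h1.symm), hinj (h4.trans h2.symm)]
    have hxyσ : σ x ≠ σ y := fun h' => hlt.ne (σ.injective h')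
    have hiff : ((Equiv.swap c d * σ) x < (Equiv.swap c d * σ) y) ↔ σ x < σ y := by
      simp only [Equiv.Perm.mul_apply, Equiv.swap_apply_def]
      simp only [Fin.ext_iff, Fin.lt_def, ne_eq] at *
      split_ifs <;> omega
    by_cases hlt' : σ x < σ y
    · have hb : b (σ y) = 1 := by
        apply hg.2.2
        simp only [Fin.ext_iff, Fin.lt_def, ne_eq] at *
        omega
      simp only [pairWt, hiff, hb, mul_one]
    · simp only [pairWt, hiff, hlt', if_false]
  have hpair : ((Equiv.swap c d * σ) j < (Equiv.swap c d * σ) i) ↔ ¬ σ j < σ i := by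
    rcases h with ⟨h1, h2⟩ | ⟨h1, h2⟩ <;>
    · simp only [Equiv.Perm.mul_apply, h1, h2, Equiv.swap_apply_left, Equiv.swap_apply_right]
      rw [Fin.lt_def, Fin.lt_def]
      omega
  unfold wt
  rw [← Finset.add_sum_erase _ _ hmem, ← Finset.add_sum_erase (rowPairs n)
    (fun p => pairWt (σ p.1 < σ p.2) (a p.2)) hmem, Finset.sum_congr rfl hsame]
  simp only [pairWt, hpair]
  omega

theorem wt_mul_genData_le {e n : ℕ} {c d : Fin n} {b : Fin n → ℂ} (hg : IsGenData e c d b)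
    (σ : Equiv.Perm (Fin n)) (a : Fin n → ℂ) :
    wt (Equiv.swap c d * σ) (fun x => a x * b (σ x)) ≤ wt σ a + 1 := by
  have hcd := hg.1
  have hne : σ⁻¹ c ≠ σ⁻¹ d := fun h => by
    have := σ⁻¹.injective h
    rw [this] at hcd
    omega
  rcases lt_or_gt_of_ne hne with hlt | hlt
  · have := wt_mul_genData hg σ a hlt (Or.inl ⟨by simp, by simp⟩)
    simp only [pairWt] at this
    split_ifs at this <;> omega
  · have := wt_mul_genData hg σ a hlt (Or.inr ⟨by simp, by simp⟩)
    simp only [pairWt] at this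
    split_ifs at this <;> omega

theorem wt_one {n : ℕ} : wt (1 : Equiv.Perm (Fin n)) (fun _ => 1) = 0 := by
  refine Finset.sum_eq_zero fun p hp => ?_
  simp [pairWt, mem_rowPairs.1 hp]

theorem exists_monoMat_list_prod {e n : ℕ} (he : e ≠ 0) (hn : 2 ≤ n)
    (L : List (Matrix (Fin n) (Fin n) ℂ)) (hL : ∀ x ∈ L, x ∈ genSet e n) :
    ∃ σ a, IsCoeff e a ∧ L.prod = monoMat σ a ∧ wt σ a ≤ L.length := by
  induction L using List.reverseRecOn with
  | nil => exact ⟨1, fun _ => 1, isCoeff_one, by simp [monoMat_one], by simp [wt_one]⟩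
  | append_singleton L x ih =>
    obtain ⟨σ, a, ha, hp, hw⟩ := ih fun y hy => hL y (by simp [hy])
    obtain ⟨c, d, b, hg, rfl⟩ := exists_genData he hn (hL x (by simp))
    refine ⟨_, _, ha.mul hg.2.1 σ, by rw [List.prod_append, hp, List.prod_singleton, monoMat_mul],
      ?_⟩
    have := wt_mul_genData_le hg σ a
    simp only [List.length_append, List.length_singleton]
    omega

theorem perm_eq_one_of_lt {n : ℕ} {σ : Equiv.Perm (Fin n)} (h : ∀ i j, i < j → σ i < σ j) :
    σ = 1 := by
  have hm : StrictMono σ := fun i j => h i j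
  have hrange : Set.range σ = Set.range (id : Fin n → Fin n) := by
    rw [σ.surjective.range_eq, Set.range_id]
  exact Equiv.ext fun i => congrFun ((hm.range_inj strictMono_id).1 hrange) i

/-- Every nontrivial element has a generator shortening it from the right. -/
theorem exists_wt_descent {e n : ℕ} (he : e ≠ 0) (hn : 2 ≤ n) (σ : Equiv.Perm (Fin n))
    {a : Fin n → ℂ} (ha : IsCoeff e a) (hne : monoMat σ a ≠ 1) :
    ∃ c d b, IsGenData e c d b ∧ monoMat (Equiv.swap c d) b ∈ genSet e n ∧
      wt (Equiv.swap c d * σ) (fun x => a x * b (σ x)) + 1 = wt σ a := by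
  by_contra hno
  push Not at hno
  have : NeZero e := ⟨he⟩
  have hz := zeta_isPrimitiveRoot he
  have happ : ∀ x, σ (σ⁻¹ x) = x := fun x => by simp
  have key : ∀ m, ∀ c d : Fin n, (c : ℕ) = m → (c : ℕ) + 1 = d →
      σ⁻¹ c < σ⁻¹ d ∧ a (σ⁻¹ d) = 1 := by
    intro m
    induction m with
    | zero =>
      intro c d hc hd
      have hc' : c = ⟨0, by omega⟩ := Fin.ext hc
      have hd' : d = ⟨1, by omega⟩ := Fin.ext (by simp only; omega)
      have hgen : ∀ k, k < e → monoMat (Equiv.swap c d) (tCoeff e n k) ∈ genSet e n :=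
        fun k hk => Or.inl ⟨k, hk, by rw [tmat_eq hn, hc', hd']⟩
      have hdat : ∀ k, IsGenData e c d (tCoeff e n k) := fun k => by
        rw [hc', hd']; exact isGenData_tCoeff he hn k
      have hcd : σ⁻¹ c ≠ σ⁻¹ d := fun h => by
        have := σ⁻¹.injective h
        rw [this] at hd
        omega
      rcases lt_or_gt_of_ne hcd with hlt | hlt
      · refine ⟨hlt, ?_⟩
        by_contra h1
        have := wt_mul_genData (hdat 0) σ a hlt (Or.inl ⟨by simp, by simp⟩)
        refine hno _ _ _ (hdat 0) (hgen 0 (by omega)) ?_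
        have hlt' : c < d := by rw [Fin.lt_def]; omega
        simp only [pairWt, happ, hlt', h1, if_true, if_false,
          not_true_eq_false] at this
        omega
      · exfalso
        obtain ⟨k, hk, hka⟩ := hz.eq_pow_of_pow_eq_one (ha.1 (σ⁻¹ c))
        have := wt_mul_genData (hdat k) σ a hlt (Or.inr ⟨by simp, by simp⟩)
        refine hno _ _ _ (hdat k) (hgen k hk) ?_
        have hlt' : ¬ d < c := by rw [Fin.lt_def]; omega
        have h1 : a (σ⁻¹ c) * tCoeff e n k c = 1 := by
          simp only [tCoeff, hc, if_true]
          rw [← hka, ← mul_pow, mul_inv_cancel₀ (hz.ne_zero he), one_pow]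
        simp only [pairWt, happ, hlt', h1, if_true, if_false,
          not_false_eq_true] at this
        omega
    | succ m ih =>
      intro c d hc hd
      have hac := (ih ⟨m, by omega⟩ c rfl (by simp [hc])).2
      have hgen : monoMat (Equiv.swap c d) (fun _ => 1) ∈ genSet e n :=
        Or.inr ⟨d + 1, by omega, by omega, (smat_eq hd).symm⟩
      have hdat : IsGenData e c d (fun _ => 1) := ⟨hd, isCoeff_one, fun _ _ => rfl⟩
      have hcd : σ⁻¹ c ≠ σ⁻¹ d := fun h => by
        have := σ⁻¹.injective h
        rw [this] at hd
        omega
      rcases lt_or_gt_of_ne hcd with hlt | hlt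
      · refine ⟨hlt, ?_⟩
        by_contra h1
        have := wt_mul_genData hdat σ a hlt (Or.inl ⟨by simp, by simp⟩)
        refine hno _ _ _ hdat hgen ?_
        have hlt' : c < d := by rw [Fin.lt_def]; omega
        simp only [pairWt, happ, hlt', h1, if_true, if_false,
          not_true_eq_false] at this
        omega
      · exfalso
        have := wt_mul_genData hdat σ a hlt (Or.inr ⟨by simp, by simp⟩)
        refine hno _ _ _ hdat hgen ?_
        have hlt' : ¬ d < c := by rw [Fin.lt_def]; omega
        have h1 : a (σ⁻¹ c) * (1 : ℂ) = 1 := by rw [hac, mul_one]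
        simp only [pairWt, happ, hlt', h1, if_true, if_false,
          not_false_eq_true] at this
        omega
  have hσ : σ = 1 := by
    rw [← inv_eq_one]
    apply perm_eq_one_of_lt
    obtain ⟨m, rfl⟩ : ∃ m, n = m + 1 := ⟨n - 1, by omega⟩
    have : StrictMono (σ⁻¹ : Equiv.Perm (Fin (m + 1))) :=
      Fin.strictMono_iff_lt_succ.2 fun i => (key i i.castSucc i.succ (by simp) (by simp)).1
    exact fun i j hij => this hij
  subst hσ
  have ha1 : ∀ i : Fin n, (i : ℕ) ≠ 0 → a i = 1 := fun i hi => by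
    simpa using (key (i - 1) ⟨i - 1, by omega⟩ i rfl (by simp only; omega)).2
  have ha0 : a ⟨0, by omega⟩ = 1 := by
    rw [← ha.2]
    symm
    refine Finset.prod_eq_single _ (fun i _ hi => ha1 i fun h => hi (Fin.ext h)) (by simp)
  refine hne ?_
  rw [← monoMat_one]
  congr 1
  funext i
  by_cases hi : (i : ℕ) = 0
  · rw [← ha0]; congr 1; exact Fin.ext hi
  · exact ha1 i hi

theorem exists_list_length_eq_wt {e n : ℕ} (he : e ≠ 0) (hn : 2 ≤ n) (m : ℕ) :
    ∀ (σ : Equiv.Perm (Fin n)) (a : Fin n → ℂ), IsCoeff e a → wt σ a = m →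
      ∃ L : List (Matrix (Fin n) (Fin n) ℂ), (∀ x ∈ L, x ∈ genSet e n) ∧
        L.prod = monoMat σ a ∧ L.length = m := by
  induction m with
  | zero =>
    intro σ a ha hm
    have h1 : monoMat σ a = 1 := by
      by_contra hne
      obtain ⟨c, d, b, -, -, h⟩ := exists_wt_descent he hn σ ha hne
      omega
    exact ⟨[], by simp, by simp [h1], rfl⟩
  | succ m ih =>
    intro σ a ha hm
    have h1 : monoMat σ a ≠ 1 := fun h => by
      rw [← monoMat_one] at h
      obtain ⟨rfl, rfl⟩ := monoMat_injective he ha h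
      rw [wt_one] at hm
      omega
    obtain ⟨c, d, b, hg, hmem, h⟩ := exists_wt_descent he hn σ ha h1
    obtain ⟨L, hL, hp, hl⟩ := ih (Equiv.swap c d * σ) _ (ha.mul hg.2.1 σ) (by omega)
    refine ⟨L ++ [monoMat (Equiv.swap c d) b], ?_, ?_, by simp [hl]⟩
    · intro x hx
      rcases List.mem_append.1 hx with hx | hx
      · exact hL x hx
      · rw [List.mem_singleton.1 hx]; exact hmem
    · rw [List.prod_append, hp, List.prod_singleton, ← monoMat_mul, mul_assoc,
        genSet_mul_self he hn hmem, mul_one]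

theorem len_monoMat {e n : ℕ} (he : e ≠ 0) (hn : 2 ≤ n) (σ : Equiv.Perm (Fin n))
    {a : Fin n → ℂ} (ha : IsCoeff e a) : len e n (monoMat σ a) = wt σ a := by
  have hex := exists_list_length_eq_wt he hn _ σ a ha rfl
  apply le_antisymm (Nat.sInf_le hex)
  refine le_csInf ⟨_, hex⟩ ?_
  rintro l ⟨L, hL, hp, rfl⟩
  obtain ⟨τ, b, hb, hp', hw⟩ := exists_monoMat_list_prod he hn L hL
  obtain ⟨rfl, rfl⟩ := monoMat_injective he ha (hp.symm.trans hp')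
  exact hw

theorem len_le_of_mul_eq_one {e n : ℕ} (he : e ≠ 0) (hn : 2 ≤ n)
    {u v : Matrix (Fin n) (Fin n) ℂ} (hu : IsGeen e n u) (huv : u * v = 1) :
    len e n v ≤ len e n u := by
  obtain ⟨σ, a, ha, rfl⟩ := (isGeen_iff he).1 hu
  obtain ⟨L, hL, hp, hl⟩ := exists_list_length_eq_wt he hn _ σ a ha rfl
  rw [len_monoMat he hn σ ha]
  refine Nat.sInf_le ⟨L.reverse, by simpa using hL, ?_, by simpa using hl⟩
  have hrev : ∀ K : List (Matrix (Fin n) (Fin n) ℂ), (∀ x ∈ K, x ∈ genSet e n) →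
      K.reverse.prod * K.prod = 1 := by
    intro K hK
    induction K with
    | nil => simp
    | cons x K ih =>
      rw [List.reverse_cons, List.prod_append, List.prod_singleton, List.prod_cons, mul_assoc,
        ← mul_assoc x, genSet_mul_self he hn (hK x (by simp)), one_mul,
        ih fun y hy => hK y (by simp [hy])]
  have h := hrev L hL
  rw [hp] at h
  calc L.reverse.prod = L.reverse.prod * (monoMat σ a * v) := by rw [huv, mul_one]
    _ = v := by rw [← mul_assoc, h, one_mul]

theorem len_eq_of_mul_eq_one {e n : ℕ} (he : e ≠ 0) (hn : 2 ≤ n)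
    {u v : Matrix (Fin n) (Fin n) ℂ} (hu : IsGeen e n u) (hv : IsGeen e n v) (huv : u * v = 1) :
    len e n u = len e n v :=
  le_antisymm (len_le_of_mul_eq_one he hn hv (mul_eq_one_comm.1 huv))
    (len_le_of_mul_eq_one he hn hu huv)

theorem exists_inverse {e n : ℕ} (he : e ≠ 0) {u : Matrix (Fin n) (Fin n) ℂ}
    (hu : IsGeen e n u) : ∃ σ a, IsCoeff e a ∧ u * monoMat σ a = 1 := by
  obtain ⟨σ, a, ha, rfl⟩ := (isGeen_iff he).1 hu
  refine ⟨σ⁻¹, fun i => (a (σ⁻¹ i))⁻¹, ha.inv _, ?_⟩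
  rw [monoMat_mul, ← monoMat_one]
  congr 1
  · simp
  · funext i
    simp [ha.ne_zero he]

theorem sum_rowPairs_two (n : ℕ) : ∑ _p ∈ rowPairs n, 2 = n * (n - 1) := by
  have h : (rowPairs n).card = ∑ i : Fin n, (i : ℕ) := by
    rw [rowPairs, Finset.card_filter, Fintype.sum_prod_type_right]
    refine Finset.sum_congr rfl fun i _ => ?_
    rw [← Finset.card_filter, Finset.filter_gt_eq_Iio, Fin.card_Iio]
  rw [Finset.sum_const, h, smul_eq_mul, Fin.sum_univ_eq_sum_range (fun i => i),
    Finset.sum_range_id_mul_two]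

theorem wt_eq_max_iff {n : ℕ} (σ : Equiv.Perm (Fin n)) (a : Fin n → ℂ) :
    wt σ a = n * (n - 1) ↔ σ = 1 ∧ ∀ i : Fin n, (i : ℕ) ≠ 0 → a i ≠ 1 := by
  rw [← sum_rowPairs_two, wt, Finset.sum_eq_sum_iff_of_le fun p _ => by
    unfold pairWt; split_ifs <;> omega]
  constructor
  · intro h
    have h' : ∀ j i, j < i → σ j < σ i ∧ a i ≠ 1 := fun j i hji => by
      have := h (j, i) (mem_rowPairs.2 hji)
      simp only [pairWt] at this
      split_ifs at this with h1 h2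
      · exact ⟨h1, h2⟩
      · omega
    exact ⟨perm_eq_one_of_lt fun j i hji => (h' j i hji).1,
      fun i hi => (h' ⟨0, by omega⟩ i (by rw [Fin.lt_def]; simp only; omega)).2⟩
  · rintro ⟨rfl, h⟩ ⟨j, i⟩ hp
    have hji := mem_rowPairs.1 hp
    have : a i ≠ 1 := h i (by simp only [Fin.lt_def] at hji; omega)
    simpa [pairWt, this] using hji

theorem wt_add_wt_eq_max_iff {n : ℕ} (σ : Equiv.Perm (Fin n)) (a b : Fin n → ℂ)
    (hab : ∀ j i, j < i → σ j < σ i → a i = 1 → b i ≠ 1) :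
    wt σ a + wt σ b = n * (n - 1) ↔ ∀ j i, j < i → σ j < σ i → a i = 1 ∨ b i = 1 := by
  have hle : ∀ p ∈ rowPairs n,
      2 ≤ pairWt (σ p.1 < σ p.2) (a p.2) + pairWt (σ p.1 < σ p.2) (b p.2) := fun p hp => by
    have := hab p.1 p.2 (mem_rowPairs.1 hp)
    unfold pairWt
    split_ifs <;> simp_all
  rw [← sum_rowPairs_two, wt, wt, ← Finset.sum_add_distrib, eq_comm,
    Finset.sum_eq_sum_iff_of_le hle]
  constructor
  · intro h j i hji hσ
    have := h (j, i) (mem_rowPairs.2 hji)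
    by_contra hc
    push Not at hc
    simp [pairWt, hσ, hc.1, hc.2] at this
  · rintro h ⟨j, i⟩ hp
    have hji := mem_rowPairs.1 hp
    have h1 := hab j i hji
    have h2 := h j i hji
    simp only [pairWt]
    split_ifs <;> simp_all

theorem lDiv_diagonal_iff {e n : ℕ} (he : e ≠ 0) (hn : 2 ≤ n) {d : Fin n → ℂ} (hd : IsCoeff e d)
    (hd1 : ∀ i : Fin n, (i : ℕ) ≠ 0 → d i ≠ 1) {u : Matrix (Fin n) (Fin n) ℂ}
    (hu : IsGeen e n u) {σ : Equiv.Perm (Fin n)} {a : Fin n → ℂ} (ha : IsCoeff e a)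
    (h : u * monoMat σ a = 1) :
    LDiv e n u (monoMat 1 d) ↔ ∀ j i, j < i → σ j < σ i → a i = 1 ∨ a i * d (σ i) = 1 := by
  have h' := mul_eq_one_comm.1 h
  have hlen := len_eq_of_mul_eq_one he hn hu ((isGeen_iff he).2 ⟨σ, a, ha, rfl⟩) h
  rw [← wt_add_wt_eq_max_iff σ a fun i => a i * d (σ i)]
  swap
  · intro j i _ hσ h1
    rw [h1, one_mul]
    exact hd1 _ (by simp only [Fin.lt_def] at hσ; omega)
  have hmul := monoMat_mul σ 1 a d
  rw [one_mul] at hmul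
  have hw : len e n (monoMat 1 d) = n * (n - 1) := by
    rw [len_monoMat he hn 1 hd, wt_eq_max_iff]
    exact ⟨rfl, hd1⟩
  rw [len_monoMat he hn σ ha] at hlen
  rw [← len_monoMat he hn σ (ha.mul hd σ), ← hmul, ← hlen]
  constructor
  · rintro ⟨v, -, hv, hl⟩
    rw [← hw, ← hl, ← hv, ← mul_assoc, h', one_mul]
  · intro hl
    refine ⟨monoMat σ a * monoMat 1 d, ?_, ?_, hl.trans hw.symm⟩
    · rw [hmul]
      exact (isGeen_iff he).2 ⟨_, _, ha.mul hd σ, rfl⟩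
    · rw [← mul_assoc, h, one_mul]

theorem rDiv_diagonal_iff {e n : ℕ} (he : e ≠ 0) (hn : 2 ≤ n) {d : Fin n → ℂ} (hd : IsCoeff e d)
    (hd1 : ∀ i : Fin n, (i : ℕ) ≠ 0 → d i ≠ 1) {u : Matrix (Fin n) (Fin n) ℂ}
    (hu : IsGeen e n u) {σ : Equiv.Perm (Fin n)} {a : Fin n → ℂ} (ha : IsCoeff e a)
    (h : u * monoMat σ a = 1) :
    RDiv e n u (monoMat 1 d) ↔ ∀ j i, j < i → σ j < σ i → a i = 1 ∨ d i * a i = 1 := by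
  have h' := mul_eq_one_comm.1 h
  have hlen := len_eq_of_mul_eq_one he hn hu ((isGeen_iff he).2 ⟨σ, a, ha, rfl⟩) h
  rw [← wt_add_wt_eq_max_iff σ a fun i => d i * a i]
  swap
  · intro j i hji _ h1
    rw [h1, mul_one]
    exact hd1 _ (by simp only [Fin.lt_def] at hji; omega)
  have hmul := monoMat_mul 1 σ d a
  rw [mul_one] at hmul
  have hda : IsCoeff e fun i => d i * a i := hd.mul ha 1
  have hw : len e n (monoMat 1 d) = n * (n - 1) := by
    rw [len_monoMat he hn 1 hd, wt_eq_max_iff]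
    exact ⟨rfl, hd1⟩
  rw [len_monoMat he hn σ ha] at hlen
  simp only [Equiv.Perm.one_apply] at hmul
  rw [← len_monoMat he hn σ hda, ← hmul, ← hlen, add_comm]
  constructor
  · rintro ⟨v, -, hv, hl⟩
    rw [← hw, ← hl, ← hv, mul_assoc, h, mul_one]
  · intro hl
    refine ⟨monoMat 1 d * monoMat σ a, ?_, ?_, hl.trans hw.symm⟩
    · rw [hmul]
      exact (isGeen_iff he).2 ⟨_, _, hda, rfl⟩
    · rw [mul_assoc, h', mul_one]

theorem isBalancedElt_diagonal {e n : ℕ} (he : e ≠ 0) (hn : 2 ≤ n) {d : Fin n → ℂ}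
    (hd : IsCoeff e d) (hd1 : ∀ i : Fin n, (i : ℕ) ≠ 0 → d i ≠ 1)
    (hconst : ∀ p q : Fin n, (p : ℕ) ≠ 0 → (q : ℕ) ≠ 0 → d p = d q) :
    IsBalancedElt e n (monoMat 1 d) := by
  intro u hu
  obtain ⟨σ, a, ha, h⟩ := exists_inverse he hu
  rw [lDiv_diagonal_iff he hn hd hd1 hu ha h, rDiv_diagonal_iff he hn hd hd1 hu ha h]
  refine forall₄_congr fun j i hji hσ => ?_
  rw [mul_comm (d i), hconst i (σ i)]
  · simp only [Fin.lt_def] at hji; omega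
  · simp only [Fin.lt_def] at hσ; omega

theorem not_isBalancedElt_diagonal {e n : ℕ} (he : e ≠ 0) (hn : 2 ≤ n) {d : Fin n → ℂ}
    (hd : IsCoeff e d) (hd1 : ∀ i : Fin n, (i : ℕ) ≠ 0 → d i ≠ 1) {p q : Fin n}
    (hp : (p : ℕ) ≠ 0) (hq : (q : ℕ) ≠ 0) (hpq : d p ≠ d q) :
    ¬ IsBalancedElt e n (monoMat 1 d) := by
  intro hbal
  let z : Fin n := ⟨0, by omega⟩
  have hpz : p ≠ z := fun h => hp (by rw [h])
  have hqz : q ≠ z := fun h => hq (by rw [h])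
  let a : Fin n → ℂ := fun i => if i = z then d q else if i = p then (d q)⁻¹ else 1
  have hdq := hd.ne_zero he q
  have ha : IsCoeff e a := by
    constructor
    · intro i
      simp only [a]
      split_ifs
      · exact hd.1 q
      · rw [inv_pow, hd.1, inv_one]
      · simp
    · rw [Finset.prod_eq_mul z p hpz.symm (fun c _ hc => by simp [a, hc.1, hc.2]) (by simp)
        (by simp)]
      simp [a, hpz, hdq]
  have hg : IsGeen e n (monoMat (Equiv.swap p q) a) := (isGeen_iff he).2 ⟨_, _, ha, rfl⟩
  obtain ⟨τ, b, hb, hinv⟩ := exists_inverse he hg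
  have hinv' := mul_eq_one_comm.1 hinv
  have hu : IsGeen e n (monoMat τ b) := (isGeen_iff he).2 ⟨_, _, hb, rfl⟩
  have hz := hbal _ hu
  rw [lDiv_diagonal_iff he hn hd hd1 hu ha hinv', rDiv_diagonal_iff he hn hd hd1 hu ha hinv'] at hz
  have hap : a p = (d q)⁻¹ := by simp [a, hpz]
  have hlt : z < p := by rw [Fin.lt_def]; simp only [z]; omega
  have hltσ : Equiv.swap p q z < Equiv.swap p q p := by
    rw [Equiv.swap_apply_of_ne_of_ne hpz.symm hqz.symm, Equiv.swap_apply_left, Fin.lt_def]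
    simp only [z]; omega
  have hleft : ∀ j i, j < i → Equiv.swap p q j < Equiv.swap p q i →
      a i = 1 ∨ a i * d (Equiv.swap p q i) = 1 := by
    intro j i hji _
    by_cases hi : i = p
    · right
      rw [hi, hap, Equiv.swap_apply_left, inv_mul_cancel₀ hdq]
    · left
      have : i ≠ z := fun h => by
        rw [h, Fin.lt_def] at hji
        simp [z] at hji
      simp [a, hi, this]
  rcases hz.1 hleft z p hlt hltσ with h | h
  · rw [hap, inv_eq_one] at h
    exact hd1 q hq h
  · rw [hap, mul_inv_eq_one₀ hdq] at h
    exact hpq h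

/-- The diagonal entries of `λ^k`. -/
def lamCoeff (e n k : ℕ) : Fin n → ℂ := fun i =>
  if (i : ℕ) = 0 then ((zeta e)⁻¹ ^ (n - 1)) ^ k else zeta e ^ k

theorem lamMat_pow (e n k : ℕ) : lamMat e n ^ k = monoMat 1 (lamCoeff e n k) := by
  have : lamMat e n = Matrix.diagonal fun i : Fin n =>
      if (i : ℕ) = 0 then (zeta e)⁻¹ ^ (n - 1) else zeta e := by
    ext i j
    simp [lamMat, Matrix.diagonal_apply]
  rw [this, Matrix.diagonal_pow, monoMat_one_eq_diagonal]
  congr 1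
  funext i
  simp only [Pi.pow_apply, lamCoeff]
  split_ifs <;> rfl

theorem prod_eq_zero_entry_mul {n : ℕ} (hn : 2 ≤ n) (d : Fin n → ℂ) (z : ℂ)
    (hd : ∀ i : Fin n, (i : ℕ) ≠ 0 → d i = z) :
    ∏ i, d i = d ⟨0, by omega⟩ * z ^ (n - 1) := by
  obtain ⟨m, rfl⟩ : ∃ m, n = m + 1 := ⟨n - 1, by omega⟩
  rw [Fin.prod_univ_succ]
  simp only [fun i : Fin m => hd i.succ (by simp)]
  simp

theorem isCoeff_lamCoeff {e n : ℕ} (he : e ≠ 0) (hn : 2 ≤ n) (k : ℕ) :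
    IsCoeff e (lamCoeff e n k) := by
  have hz := (zeta_isPrimitiveRoot he).pow_eq_one
  have h0 := (zeta_isPrimitiveRoot he).ne_zero he
  constructor
  · intro i
    unfold lamCoeff
    split_ifs
    · rw [← pow_mul, ← pow_mul, ← mul_assoc, mul_comm, pow_mul, inv_pow, hz, inv_one, one_pow]
    · rw [← pow_mul, mul_comm, pow_mul, hz, one_pow]
  · rw [prod_eq_zero_entry_mul hn _ (zeta e ^ k) fun i hi => by simp [lamCoeff, hi]]
    simp only [lamCoeff, if_true]
    rw [← pow_mul, ← pow_mul, mul_comm k, ← mul_pow, inv_mul_cancel₀ h0, one_pow]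

theorem exists_diagonal_of_len_eq {e n : ℕ} (he : e ≠ 0) (hn : 2 ≤ n)
    {w : Matrix (Fin n) (Fin n) ℂ} (hw : IsGeen e n w) (hl : len e n w = n * (n - 1)) :
    ∃ d, IsCoeff e d ∧ (∀ i : Fin n, (i : ℕ) ≠ 0 → d i ≠ 1) ∧ w = monoMat 1 d := by
  obtain ⟨σ, d, hd, rfl⟩ := (isGeen_iff he).1 hw
  rw [len_monoMat he hn σ hd, wt_eq_max_iff] at hl
  obtain ⟨rfl, h⟩ := hl
  exact ⟨d, hd, h, rfl⟩

/-- The balanced elements of `G(e,e,n)` of maximal length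
`n(n-1)` are exactly `λ^k` for `1 ≤ k ≤ e-1`; in particular a diagonal
element of maximal length with two distinct diagonal entries in positions
`2,…,n` is not balanced. -/
theorem statement9 (e n : ℕ) (he : 1 < e) (hn : 2 ≤ n) :
    (∀ w, IsGeen e n w →
      ((len e n w = n * (n - 1) ∧ IsBalancedElt e n w) ↔
        ∃ k, 1 ≤ k ∧ k ≤ e - 1 ∧ w = lamMat e n ^ k)) ∧
    (∀ w, IsGeen e n w → len e n w = n * (n - 1) →
      (∃ p q : Fin n, 1 ≤ (p : ℕ) ∧ 1 ≤ (q : ℕ) ∧ w p p ≠ w q q) →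
      ¬ IsBalancedElt e n w) := by
  have he0 : e ≠ 0 := by omega
  have : NeZero e := ⟨he0⟩
  have hz := zeta_isPrimitiveRoot he0
  refine ⟨fun w hw => ⟨?_, ?_⟩, ?_⟩
  · rintro ⟨hl, hbal⟩
    obtain ⟨d, hd, hd1, rfl⟩ := exists_diagonal_of_len_eq he0 hn hw hl
    have hconst : ∀ p q : Fin n, (p : ℕ) ≠ 0 → (q : ℕ) ≠ 0 → d p = d q := fun p q hp hq => by
      by_contra hpq
      exact not_isBalancedElt_diagonal he0 hn hd hd1 hp hq hpq hbal
    obtain ⟨k, hk, hkd⟩ := hz.eq_pow_of_pow_eq_one (hd.1 ⟨1, by omega⟩)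
    have hk0 : k ≠ 0 := by
      rintro rfl
      exact hd1 ⟨1, by omega⟩ (by simp) (by rw [← hkd, pow_zero])
    have hdk : ∀ i : Fin n, (i : ℕ) ≠ 0 → d i = zeta e ^ k := fun i hi => by
      rw [hkd]; exact hconst _ _ hi (by simp)
    refine ⟨k, by omega, by omega, ?_⟩
    rw [lamMat_pow]
    congr 1
    funext i
    by_cases hi : (i : ℕ) = 0
    · have h1 := prod_eq_zero_entry_mul hn d _ hdk
      have h2 := prod_eq_zero_entry_mul hn (lamCoeff e n k) (zeta e ^ k)
        fun i hi => by simp [lamCoeff, hi]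
      rw [hd.2] at h1
      rw [(isCoeff_lamCoeff he0 hn k).2, h1] at h2
      rw [show i = ⟨0, by omega⟩ from Fin.ext hi]
      exact mul_right_cancel₀ (pow_ne_zero _ (pow_ne_zero _ (hz.ne_zero he0))) h2
    · rw [hdk i hi]
      simp [lamCoeff, hi]
  · rintro ⟨k, hk1, hk2, rfl⟩
    have hd := isCoeff_lamCoeff he0 hn k
    have hd1 : ∀ i : Fin n, (i : ℕ) ≠ 0 → lamCoeff e n k i ≠ 1 := fun i hi => by
      simp only [lamCoeff, hi, if_false]
      exact hz.pow_ne_one_of_pos_of_lt (by omega) (by omega)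
    rw [lamMat_pow]
    refine ⟨?_, isBalancedElt_diagonal he0 hn hd hd1 fun p q hp hq => by simp [lamCoeff, hp, hq]⟩
    rw [len_monoMat he0 hn 1 hd, wt_eq_max_iff]
    exact ⟨rfl, hd1⟩
  · rintro w hw hl ⟨p, q, hp, hq, hpq⟩
    obtain ⟨d, hd, hd1, rfl⟩ := exists_diagonal_of_len_eq he0 hn hw hl
    refine not_isBalancedElt_diagonal he0 hn hd hd1 (p := p) (q := q) (by omega) (by omega) ?_
    simpa [monoMat] using hpq
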